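/- Let x, y be real numbers with 0 ≤ y ≤ x and x + 3y < 1. Then (x − y)·log((1 − x + 3y)/(1 − x − 3y)) ≥ 2y·log((1 + 2x)/(1 − x + 3y)). (Equivalently, with α = 3y/(1 − x) and β = 3(x − y)/(1 − x + 3y), one has (x − y)·log((1 + α)/(1 − α)) − 2y·log(1 + β) ≥ 2√3·(x − y)·y·(1/(1 − x) − 1/(1 − x + 3y))·(√3)⁻¹·√3 ≥ 0; the stated inequality is the resulting nonnegativity.) -/

import Mathlib

theorem stmt_7 :
    ∀ x y : ℝ, 0 ≤ y → y ≤ x → x + 3 * y < 1 →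
      2 * y * Real.log ((1 + 2 * x) / (1 - x + 3 * y)) ≤
        (x - y) * Real.log ((1 - x + 3 * y) / (1 - x - 3 * y)) := by
  intro x y hy hyx hxy
  have h₁ : 0 < 1 - x - 3 * y := by linarith
  have h₂ : 0 < 1 - x + 3 * y := by linarith
  have h₃ : 0 < 1 + 2 * x := by linarith
  have upper := Real.log_le_sub_one_of_pos (div_pos h₃ h₂)
  have lower := Real.one_sub_inv_le_log_of_pos (div_pos h₂ h₁)
  calc 2 * y * Real.log ((1 + 2 * x) / (1 - x + 3 * y))
      ≤ 2 * y * ((1 + 2 * x) / (1 - x + 3 * y) - 1) := by gcongr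
    _ = (x - y) * (1 - ((1 - x + 3 * y) / (1 - x - 3 * y))⁻¹) := by
        rw [inv_div, div_sub_one h₂.ne', one_sub_div h₂.ne']
        ring
    _ ≤ (x - y) * Real.log ((1 - x + 3 * y) / (1 - x - 3 * y)) :=
        mul_le_mul_of_nonneg_left lower (sub_nonneg.mpr hyx)
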